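/- Fix n ≥ 1 and a finite-dimensional real vector space V, and let Σ_n be the commutative monoid on {0, 1, …, n} with operation i·j = min(i+j, n) and identity 0. Then the map from the monoid algebra M = End(V)[Σ_n] to End(V^{n+1}) sending Σ_{i=0}^n a_i σ_i to the linear feed-forward operator x ↦ (j ↦ Σ_{i=0}^n a_i x_{max(j−i,0)}) is a homomorphism of unital associative ℝ-algebras. -/

import Mathlib

/-- The commutative monoid `Σ_n` on `{0, …, n}` with operation `i·j = min (i+j) n`. -/
structure SigmaM (n : ℕ) where
  val : Fin (n + 1)
deriving DecidableEq

namespace SigmaM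

theorem ext' {n : ℕ} {a b : SigmaM n} (h : a.val = b.val) : a = b := by
  cases a; cases b; cases h; rfl

instance (n : ℕ) : Mul (SigmaM n) :=
  ⟨fun i j => ⟨⟨min (i.val.val + j.val.val) n, Nat.lt_succ_of_le (min_le_right _ _)⟩⟩⟩

instance (n : ℕ) : One (SigmaM n) := ⟨⟨⟨0, Nat.succ_pos n⟩⟩⟩

instance (n : ℕ) : CommMonoid (SigmaM n) where
  mul_assoc a b c := by
    apply ext'; apply Fin.ext
    show min (min (a.val.val + b.val.val) n + c.val.val) n
      = min (a.val.val + min (b.val.val + c.val.val) n) n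
    omega
  one_mul a := by
    apply ext'; apply Fin.ext
    show min (0 + a.val.val) n = a.val.val
    have := a.val.isLt; omega
  mul_one a := by
    apply ext'; apply Fin.ext
    show min (a.val.val + 0) n = a.val.val
    have := a.val.isLt; omega
  mul_comm a b := by
    apply ext'; apply Fin.ext
    show min (a.val.val + b.val.val) n = min (b.val.val + a.val.val) n
    omega

end SigmaM

/-- The operator `a N_i ∈ End(V^{n+1})`, `(a N_i x)_j = a (x_{max(j-i,0)})`. -/
def ffN (n : ℕ) (V : Type*) [AddCommGroup V] [Module ℝ V] (i : ℕ) (a : Module.End ℝ V) :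
    Module.End ℝ (Fin (n + 1) → V) :=
  LinearMap.pi fun j : Fin (n + 1) =>
    a ∘ₗ LinearMap.proj (⟨j.val - i, Nat.lt_of_le_of_lt (Nat.sub_le _ _) j.isLt⟩ : Fin (n + 1))

/-- The linear feed-forward operator `(A x)_j = Σ_{i=0}^n a_i x_{max(j-i,0)}`. -/
def ffOp (n : ℕ) (V : Type*) [AddCommGroup V] [Module ℝ V]
    (a : Fin (n + 1) → Module.End ℝ V) : Module.End ℝ (Fin (n + 1) → V) :=
  ∑ i : Fin (n + 1), ffN n V i.val (a i)

/-- `End(V)` acting coordinatewise on `V^{n+1}`, as an algebra homomorphism. -/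
def diagonalAlgHom (n : ℕ) (V : Type*) [AddCommGroup V] [Module ℝ V] :
    Module.End ℝ V →ₐ[ℝ] Module.End ℝ (Fin (n + 1) → V) :=
  AlgHom.ofLinearMap
    { toFun := ffN n V 0
      map_add' := fun _ _ => rfl
      map_smul' := fun _ _ => rfl }
    rfl (fun _ _ => rfl)

/-- The monoid `Σ_n` acting on `V^{n+1}` by the truncated shifts `(N_i x)_j = x_{max(j-i,0)}`. -/
def shiftMonoidHom (n : ℕ) (V : Type*) [AddCommGroup V] [Module ℝ V] :
    SigmaM n →* Module.End ℝ (Fin (n + 1) → V) where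
  toFun s := ffN n V s.val 1
  map_one' := rfl
  map_mul' s t := by
    refine LinearMap.ext fun x => funext fun j => ?_
    change x ⟨j.val - min (s.val.val + t.val.val) n, _⟩ = x ⟨j.val - s.val.val - t.val.val, _⟩
    congr 2
    omega

theorem commute_diagonalAlgHom_shiftMonoidHom (n : ℕ) (V : Type*) [AddCommGroup V] [Module ℝ V]
    (a : Module.End ℝ V) (s : SigmaM n) :
    Commute (diagonalAlgHom n V a) (shiftMonoidHom n V s) :=
  rfl

/-- The algebra homomorphism `End(V)[Σ_n] → End(V^{n+1})` sending `a σ_i` to `a N_i`. -/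
noncomputable def feedForwardAlgHom (n : ℕ) (V : Type*) [AddCommGroup V] [Module ℝ V] :
    MonoidAlgebra (Module.End ℝ V) (SigmaM n) →ₐ[ℝ] Module.End ℝ (Fin (n + 1) → V) :=
  MonoidAlgebra.liftNCAlgHom (diagonalAlgHom n V) (shiftMonoidHom n V)
    (commute_diagonalAlgHom_shiftMonoidHom n V)

theorem feedForwardAlgHom_single (n : ℕ) (V : Type*) [AddCommGroup V] [Module ℝ V]
    (s : SigmaM n) (a : Module.End ℝ V) :
    feedForwardAlgHom n V (MonoidAlgebra.single s a) = ffN n V s.val a :=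
  MonoidAlgebra.liftNC_single _ _ _ _

/-- The map from the monoid algebra `M = End(V)[Σ_n]` to
`End(V^{n+1})` sending `Σᵢ aᵢ σᵢ` to the linear feed-forward operator is a
homomorphism of unital associative `ℝ`-algebras. -/
theorem semigroupRing_to_endomorphisms (n : ℕ) (hn : 1 ≤ n) (V : Type*)
    [AddCommGroup V] [Module ℝ V] [FiniteDimensional ℝ V] :
    ∃ Φ : MonoidAlgebra (Module.End ℝ V) (SigmaM n) →ₐ[ℝ] Module.End ℝ (Fin (n + 1) → V),
      ∀ a : Fin (n + 1) → Module.End ℝ V,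
        Φ (∑ i : Fin (n + 1), MonoidAlgebra.single (SigmaM.mk i) (a i)) = ffOp n V a := by
  refine ⟨feedForwardAlgHom n V, fun a => ?_⟩
  rw [map_sum]
  exact Finset.sum_congr rfl fun i _ => feedForwardAlgHom_single n V ⟨i⟩ (a i)
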